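/- Let 𝒳 ⊆ ℝ^d be compact, let h : 𝒳 → ℝ^p be continuous, let β ∈ ℝ^p, and let ν : ℝ → ℝ be continuous with ν(t) > 0 for all t ∈ ℝ. For a design w on 𝒳 define F(w) = Σ_x w(x) · ν(βᵀh(x)) · h(x)h(x)ᵀ. If w is a design with det F(w) > 0, then w is D-optimal if and only if max_{x ∈ 𝒳} ν(βᵀh(x)) · h(x)ᵀ F(w)⁻¹ h(x) ≤ p. -/

import Mathlib

open Matrix

/-- A *design on the set `𝒳`*: a finitely supported weight function with
nonnegative weights summing to `1`, supported inside `𝒳`. -/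
def IsDesignOn {d : ℕ} (𝒳 : Set (Fin d → ℝ)) (w : (Fin d → ℝ) →₀ ℝ) : Prop :=
  (∀ x, 0 ≤ w x) ∧ w.sum (fun _ c => c) = 1 ∧ ↑w.support ⊆ 𝒳

/-- The GLM information matrix `F(w) = ∑ₓ w(x) ν(βᵀh(x)) h(x)h(x)ᵀ` of a design `w`. -/
noncomputable def glmInfoMatrix {d p : ℕ} (h : (Fin d → ℝ) → Fin p → ℝ) (β : Fin p → ℝ)
    (ν : ℝ → ℝ) (w : (Fin d → ℝ) →₀ ℝ) : Matrix (Fin p) (Fin p) ℝ :=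
  w.sum fun x c => (c * ν (β ⬝ᵥ h x)) • Matrix.vecMulVec (h x) (h x)


lemma glm_add {d p : ℕ} (h : (Fin d → ℝ) → Fin p → ℝ) (β : Fin p → ℝ)
    (ν : ℝ → ℝ) (w w' : (Fin d → ℝ) →₀ ℝ) :
    glmInfoMatrix h β ν (w + w') = glmInfoMatrix h β ν w + glmInfoMatrix h β ν w' := by
  unfold glmInfoMatrix
  rw [Finsupp.sum_add_index']
  · intro x; simp
  · intro x a b; rw [add_mul, add_smul]

lemma glm_smul {d p : ℕ} (h : (Fin d → ℝ) → Fin p → ℝ) (β : Fin p → ℝ)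
    (ν : ℝ → ℝ) (t : ℝ) (w : (Fin d → ℝ) →₀ ℝ) :
    glmInfoMatrix h β ν (t • w) = t • glmInfoMatrix h β ν w := by
  unfold glmInfoMatrix
  rw [Finsupp.sum_smul_index' (by intro x; simp), Finsupp.smul_sum]
  simp only [smul_eq_mul, smul_smul, mul_assoc]

lemma glm_single {d p : ℕ} (h : (Fin d → ℝ) → Fin p → ℝ) (β : Fin p → ℝ)
    (ν : ℝ → ℝ) (x : Fin d → ℝ) (t : ℝ) :
    glmInfoMatrix h β ν (Finsupp.single x t) =
      (t * ν (β ⬝ᵥ h x)) • Matrix.vecMulVec (h x) (h x) := by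
  unfold glmInfoMatrix
  rw [Finsupp.sum_single_index (by simp)]

lemma glm_psd {d p : ℕ} (h : (Fin d → ℝ) → Fin p → ℝ) (β : Fin p → ℝ)
    (ν : ℝ → ℝ) (hν : ∀ t, 0 < ν t) (w : (Fin d → ℝ) →₀ ℝ) (hw : ∀ x, 0 ≤ w x) :
    (glmInfoMatrix h β ν w).PosSemidef := by
  unfold glmInfoMatrix Finsupp.sum
  refine Matrix.posSemidef_sum _ fun x _ => ?_
  refine Matrix.PosSemidef.smul ?_ (mul_nonneg (hw x) (hν _).le)
  simpa using Matrix.posSemidef_vecMulVec_self_star (h x)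

lemma trace_mul_vecMulVec_self {p : ℕ} (G : Matrix (Fin p) (Fin p) ℝ) (v : Fin p → ℝ) :
    (G * Matrix.vecMulVec v v).trace = v ⬝ᵥ (G *ᵥ v) := by
  rw [Matrix.mul_vecMulVec, Matrix.trace_vecMulVec, dotProduct_comm]

lemma glm_trace {d p : ℕ} (h : (Fin d → ℝ) → Fin p → ℝ) (β : Fin p → ℝ)
    (ν : ℝ → ℝ) (w : (Fin d → ℝ) →₀ ℝ) (G : Matrix (Fin p) (Fin p) ℝ) :
    (G * glmInfoMatrix h β ν w).trace =
      w.sum fun x c => c * (ν (β ⬝ᵥ h x) * (h x ⬝ᵥ (G *ᵥ h x))) := by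
  unfold glmInfoMatrix Finsupp.sum
  rw [Matrix.mul_sum, Matrix.trace_sum]
  refine Finset.sum_congr rfl fun x _ => ?_
  rw [Matrix.mul_smul, Matrix.trace_smul, trace_mul_vecMulVec_self, smul_eq_mul, mul_assoc]

lemma psd_det_le_one {p : ℕ} (A : Matrix (Fin p) (Fin p) ℝ) (hA : A.PosSemidef)
    (ht : A.trace ≤ p) : A.det ≤ 1 := by
  have h1 : A.det = ∏ i, hA.1.eigenvalues i := by
    simpa using hA.1.det_eq_prod_eigenvalues
  have h2 : A.trace = ∑ i, hA.1.eigenvalues i := by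
    simpa using hA.1.trace_eq_sum_eigenvalues
  rw [h1]
  calc ∏ i, hA.1.eigenvalues i ≤ ∏ i, Real.exp (hA.1.eigenvalues i - 1) := by
        refine Finset.prod_le_prod (fun i _ => hA.eigenvalues_nonneg i) fun i _ => ?_
        have := Real.add_one_le_exp (hA.1.eigenvalues i - 1)
        linarith
    _ = Real.exp (A.trace - p) := by
        rw [← Real.exp_sum, Finset.sum_sub_distrib, ← h2]; simp
    _ ≤ 1 := by rw [Real.exp_le_one_iff]; linarith

open scoped MatrixOrder in
lemma psd_factor {p : ℕ} (G : Matrix (Fin p) (Fin p) ℝ) (hG : G.PosSemidef) :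
    ∃ B : Matrix (Fin p) (Fin p) ℝ, G = Bᴴ * B := by
  obtain ⟨B, hB⟩ := CStarAlgebra.nonneg_iff_eq_star_mul_self.mp hG.nonneg
  exact ⟨B, hB⟩

lemma det_le_of_trace {p : ℕ} (F F' : Matrix (Fin p) (Fin p) ℝ) (hF : F.PosSemidef)
    (hdet : 0 < F.det) (hF' : F'.PosSemidef) (ht : (F⁻¹ * F').trace ≤ p) :
    F'.det ≤ F.det := by
  obtain ⟨B, hB⟩ := psd_factor F⁻¹ hF.inv
  have h1 : (B * F' * Bᴴ).det ≤ 1 := by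
    refine psd_det_le_one _ (hF'.mul_mul_conjTranspose_same B) ?_
    rw [Matrix.trace_mul_comm, ← Matrix.mul_assoc, ← hB]; exact ht
  have h2 : (B * F' * Bᴴ).det = F.det⁻¹ * F'.det := by
    have h3 : F.det⁻¹ = Bᴴ.det * B.det := by
      rw [← Matrix.det_mul, ← hB, Matrix.det_nonsing_inv, Ring.inverse_eq_inv']
    rw [h3, Matrix.det_mul, Matrix.det_mul]; ring
  rw [h2, inv_mul_le_iff₀ hdet, mul_one] at h1
  exact h1

lemma det_rank_one {p : ℕ} (F : Matrix (Fin p) (Fin p) ℝ) (hdet : 0 < F.det)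
    (v : Fin p → ℝ) (a b : ℝ) (ha : 0 < a) :
    (a • F + b • Matrix.vecMulVec v v).det =
      F.det * (a ^ p * (1 + a⁻¹ * b * (v ⬝ᵥ (F⁻¹ *ᵥ v)))) := by
  have h1 : a • F + b • Matrix.vecMulVec v v =
      a • (F + Matrix.vecMulVec ((a⁻¹ * b) • v) v) := by
    rw [smul_add, Matrix.smul_vecMulVec, smul_smul, ← mul_assoc, mul_inv_cancel₀ ha.ne', one_mul]
  rw [h1, Matrix.det_smul, Matrix.vecMulVec_eq Unit,
    Matrix.det_add_replicateCol_mul_replicateRow (isUnit_iff_ne_zero.mpr hdet.ne')]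
  have h2 : (1 + Matrix.replicateRow Unit v * F⁻¹ * Matrix.replicateCol Unit ((a⁻¹ * b) • v)).det
      = 1 + a⁻¹ * b * (v ⬝ᵥ (F⁻¹ *ᵥ v)) := by
    rw [Matrix.det_unique, Matrix.mul_assoc, ← Matrix.replicateCol_mulVec, Matrix.mulVec_smul]
    simp [Matrix.mul_apply, dotProduct, Finset.mul_sum]
  rw [h2]; simp; ring

lemma scalar_step (p : ℕ) (hp : 1 ≤ p) (s : ℝ)
    (H : ∀ t : ℝ, 0 < t → t < 1 → (1 - t) ^ p * (1 + (1 - t)⁻¹ * t * s) ≤ 1) : s ≤ p := by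
  by_contra! hs
  obtain ⟨n, rfl⟩ : ∃ n, p = n + 1 := ⟨p - 1, by omega⟩
  push_cast at hs
  have hn : (0 : ℝ) ≤ n := n.cast_nonneg
  have hs1 : 0 < s - 1 := by linarith
  have hD : 0 < ((n : ℝ) + 2) * (s - 1) := by positivity
  set t := (s - (n + 1)) / (((n : ℝ) + 2) * (s - 1)) with htdef
  have ht0 : 0 < t := div_pos (by linarith) hD
  have ht1 : t < 1 := by rw [htdef, div_lt_one hD]; nlinarith
  have hte : t * (((n : ℝ) + 2) * (s - 1)) = s - (n + 1) := div_mul_cancel₀ _ hD.ne'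
  have h1 := H t ht0 ht1
  have h2 : (1 - t) ^ (n + 1) * (1 + (1 - t)⁻¹ * t * s) = (1 - t) ^ n * (1 + t * (s - 1)) := by
    have : (1 - t) ≠ 0 := by linarith
    field_simp
    ring
  rw [h2] at h1
  have h3 : 1 + (n : ℝ) * (-t) ≤ (1 + -t) ^ n := one_add_mul_le_pow (by linarith) n
  rw [← sub_eq_add_neg] at h3
  have h4 : 0 < 1 + t * (s - 1) := by positivity
  have h5 := mul_le_mul_of_nonneg_right h3 h4.le
  have h6 : t * (s - (n + 1) - n * (t * (s - 1))) ≤ 0 := by nlinarith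
  have h7 : 0 < s - (n + 1) - n * (t * (s - 1)) := by
    have : 0 < t * (s - 1) := by positivity
    nlinarith
  have := mul_pos ht0 h7
  linarith

/-- General equivalence theorem for GLMs: a design `w` with `det F(w) > 0` is
D-optimal iff `ν(βᵀh(x)) · h(x)ᵀ F(w)⁻¹ h(x) ≤ p` for all `x ∈ 𝒳`. -/
theorem glm_Doptimal_iff_sensitivity_le
    {d p : ℕ} (hp : 1 ≤ p) (𝒳 : Set (Fin d → ℝ)) (hcpt : IsCompact 𝒳)
    (h : (Fin d → ℝ) → Fin p → ℝ) (hcont : ContinuousOn h 𝒳)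
    (β : Fin p → ℝ) (ν : ℝ → ℝ) (hνcont : Continuous ν) (hνpos : ∀ t, 0 < ν t)
    (w : (Fin d → ℝ) →₀ ℝ) (hw : IsDesignOn 𝒳 w)
    (hdet : 0 < (glmInfoMatrix h β ν w).det) :
    (∀ w' : (Fin d → ℝ) →₀ ℝ, IsDesignOn 𝒳 w' →
        (glmInfoMatrix h β ν w').det ≤ (glmInfoMatrix h β ν w).det) ↔
      ∀ x ∈ 𝒳, ν (β ⬝ᵥ h x) * (h x ⬝ᵥ ((glmInfoMatrix h β ν w)⁻¹ *ᵥ h x)) ≤ (p : ℝ) := by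
  have hF := glm_psd h β ν hνpos w hw.1
  constructor
  · intro H x hx
    refine scalar_step p hp _ fun t ht0 ht1 => ?_
    have hd : IsDesignOn 𝒳 ((1 - t) • w + Finsupp.single x t) := by
      refine ⟨fun y => ?_, ?_, ?_⟩
      · have h1 : 0 ≤ (1 - t) * w y := mul_nonneg (by linarith) (hw.1 y)
        have h2 : 0 ≤ Finsupp.single x t y := by
          rw [Finsupp.single_apply]; split_ifs <;> linarith
        simpa using add_nonneg h1 h2
      · rw [Finsupp.sum_add_index' (by simp) (by simp), Finsupp.sum_single_index rfl,
          Finsupp.sum_smul_index' (by simp)]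
        have := hw.2.1
        simp only [smul_eq_mul]
        rw [← Finsupp.mul_sum, this]; ring
      · intro y hy
        by_cases hyx : y = x
        · exact hyx ▸ hx
        · apply hw.2.2
          simp only [Finset.mem_coe, Finsupp.mem_support_iff] at hy ⊢
          intro h0
          apply hy
          simp [h0, Finsupp.single_apply, Ne.symm hyx]
    have h1 := H _ hd
    rw [glm_add, glm_smul, glm_single, det_rank_one _ hdet _ _ _ (by linarith)] at h1
    have h2 := (mul_le_iff_le_one_right hdet).mp h1
    calc _ = _ := by ring
      _ ≤ 1 := h2
  · intro H w' hw'
    refine det_le_of_trace _ _ hF hdet (glm_psd h β ν hνpos w' hw'.1) ?_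
    rw [glm_trace]
    calc _ ≤ w'.sum fun _ c => c * (p : ℝ) :=
          Finset.sum_le_sum fun x hx =>
            mul_le_mul_of_nonneg_left (H x (hw'.2.2 hx)) (hw'.1 x)
      _ = p := by rw [← Finsupp.sum_mul, hw'.2.1, one_mul]
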